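/- Let (V, V₊, v) and (W, W₊, w) be complete order unit spaces with open cones C := V₊° and D := W₊°, and suppose the cone C_usc is strongly atomic. Let Ψ: C → D be a gauge-preserving bijection with Ψ(v) = w. Then Ψ extends to an isomorphism of order unit spaces: there exists a linear bijection T: V → W with T(V₊) = W₊, T(v) = w, and T(x) = Ψ(x) for all x ∈ C. -/

import Mathlib

open scoped Topology

section Defs

/-- `(V, P, v)` is an order unit space: `P` is a proper cone, the induced order is
archimedean, `v` is an order unit, and the norm of `V` is the order unit norm. -/
structure IsOrderUnitSpace (V : Type*) [NormedAddCommGroup V] [NormedSpace ℝ V]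
    (P : Set V) (v : V) : Prop where
  add_mem : ∀ x ∈ P, ∀ y ∈ P, x + y ∈ P
  smul_mem : ∀ r : ℝ, 0 ≤ r → ∀ x ∈ P, r • x ∈ P
  proper : ∀ x : V, x ∈ P → -x ∈ P → x = 0
  archimedean : ∀ x b : V, (∀ r : ℝ, 0 ≤ r → b - r • x ∈ P) → -x ∈ P
  unit_mem : v ∈ P
  unit_order : ∀ x : V, ∃ r : ℝ, 0 < r ∧ r • v - x ∈ P
  norm_eq : ∀ x : V, ‖x‖ = sInf {r : ℝ | 0 ≤ r ∧ x + r • v ∈ P ∧ r • v - x ∈ P}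

variable {V : Type*} [NormedAddCommGroup V] [NormedSpace ℝ V]
variable {W : Type*} [NormedAddCommGroup W] [NormedSpace ℝ W]

/-- The open cone (norm interior of the cone `P`) of an order unit space. -/
def openCone (P : Set V) (v : V) : Set V := {x | ∃ ε : ℝ, 0 < ε ∧ x - ε • v ∈ P}

/-- The order unit norm `‖x‖_u` determined by an order unit `u`. -/
noncomputable def ounorm (P : Set V) (u x : V) : ℝ :=
  sInf {r : ℝ | 0 ≤ r ∧ x + r • u ∈ P ∧ r • u - x ∈ P}

/-- Thompson's metric `d_T(x,y) = log inf {r ≥ 1 : r⁻¹ y ≤ x ≤ r y}`. -/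
noncomputable def thompsonDist (P : Set V) (x y : V) : ℝ :=
  Real.log (sInf {r : ℝ | 1 ≤ r ∧ x - r⁻¹ • y ∈ P ∧ r • y - x ∈ P})

/-- `Φ` is a gauge-reversing bijection from the open cone of `(V, P, v)` onto the
open cone of `(W, Q, w)`: a bijection, homogeneous of degree `-1`,
and an order-anti-isomorphism. -/
def GaugeReversing (P : Set V) (v : V) (Q : Set W) (w : W) (Φ : V → W) : Prop :=
  Set.BijOn Φ (openCone P v) (openCone Q w) ∧
  (∀ x ∈ openCone P v, ∀ r : ℝ, 0 < r → Φ (r • x) = r⁻¹ • Φ x) ∧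
  (∀ x ∈ openCone P v, ∀ y ∈ openCone P v, (y - x ∈ P ↔ Φ x - Φ y ∈ Q))

/-- `Φ` is a gauge-preserving bijection from the open cone of `(V, P, v)` onto the
open cone of `(W, Q, w)`: a bijection, homogeneous of degree `1`,
and an order-isomorphism. -/
def GaugePreserving (P : Set V) (v : V) (Q : Set W) (w : W) (Φ : V → W) : Prop :=
  Set.BijOn Φ (openCone P v) (openCone Q w) ∧
  (∀ x ∈ openCone P v, ∀ r : ℝ, 0 < r → Φ (r • x) = r • Φ x) ∧
  (∀ x ∈ openCone P v, ∀ y ∈ openCone P v, (y - x ∈ P ↔ Φ y - Φ x ∈ Q))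

/-- `mul` is a JB-algebra structure on the order unit space `(V, P, v)` with unit
element `v` and cone of squares `P`. -/
def IsJBAlgebraStructure (P : Set V) (v : V) (mul : V →ₗ[ℝ] V →ₗ[ℝ] V) : Prop :=
  (∀ x y : V, mul x y = mul y x) ∧
  (∀ x : V, mul v x = x) ∧
  (∀ x y : V, mul x (mul y (mul x x)) = mul (mul x y) (mul x x)) ∧
  (∀ x y : V, ‖mul x y‖ ≤ ‖x‖ * ‖y‖) ∧
  (∀ x : V, ‖mul x x‖ = ‖x‖ ^ 2) ∧
  (∀ x y : V, ‖mul x x‖ ≤ ‖mul x x + mul y y‖) ∧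
  P = {y : V | ∃ x : V, mul x x = y}

/-- `S` is a `d_T`-symmetry of the open cone of `(V, P, v)` at the point `p`:
an involutive `d_T`-isometry of the open cone having `p` as an isolated fixed point. -/
def IsDTSymmetry (P : Set V) (v : V) (S : V → V) (p : V) : Prop :=
  (∀ x ∈ openCone P v, S x ∈ openCone P v) ∧
  (∀ x ∈ openCone P v, S (S x) = x) ∧
  (∀ x ∈ openCone P v, ∀ y ∈ openCone P v,
    thompsonDist P (S x) (S y) = thompsonDist P x y) ∧
  p ∈ openCone P v ∧ S p = p ∧
  (∃ ε : ℝ, 0 < ε ∧ ∀ x ∈ openCone P v, S x = x → thompsonDist P p x < ε → x = p)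

/-- A complete order unit space `(W, Q, w)` together with a gauge-reversing bijection
from the open cone of `(V, P, v)` onto the open cone of `(W, Q, w)`. -/
structure GaugeReversingTarget (V : Type*) [NormedAddCommGroup V] [NormedSpace ℝ V]
    (P : Set V) (v : V) where
  W : Type
  [instGroup : NormedAddCommGroup W]
  [instSpace : NormedSpace ℝ W]
  [instComplete : CompleteSpace W]
  Q : Set W
  w : W
  ous : IsOrderUnitSpace W Q w
  Φ : V → W
  grev : GaugeReversing P v Q w Φ

/-- The state space of the order unit space `(V, P, v)`, as a subset of the
weak-* dual of `V`. -/
def stateSpace (P : Set V) (v : V) : Set (WeakDual ℝ V) :=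
  {ρ | (∀ x ∈ P, 0 ≤ ρ x) ∧ ρ v = 1}

/-- A real-valued function on the dual is affine on `K`. -/
def AffineOnK (K : Set (WeakDual ℝ V)) (g : WeakDual ℝ V → ℝ) : Prop :=
  ∀ ρ ∈ K, ∀ σ ∈ K, ∀ t : ℝ, 0 ≤ t → t ≤ 1 →
    g ((1 - t) • ρ + t • σ) = (1 - t) * g ρ + t * g σ

/-- An extended-real-valued function on the dual is affine on `K`. -/
def AffineOnKE (K : Set (WeakDual ℝ V)) (g : WeakDual ℝ V → EReal) : Prop :=
  ∀ ρ ∈ K, ∀ σ ∈ K, ∀ t : ℝ, 0 ≤ t → t ≤ 1 →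
    g ((1 - t) • ρ + t • σ) = ((1 - t : ℝ) : EReal) * g ρ + ((t : ℝ) : EReal) * g σ

/-- Membership in the extended cone `C_usc` of nonnegative affine upper semicontinuous
functions on the state space `K`. -/
def memCusc (K : Set (WeakDual ℝ V)) (g : WeakDual ℝ V → ℝ) : Prop :=
  (∀ ρ ∈ K, 0 ≤ g ρ) ∧ AffineOnK K g ∧ UpperSemicontinuousOn g K

/-- `p` is an extremal vector of the cone `C_usc` over the state space `K`. -/
def IsExtremalCusc (K : Set (WeakDual ℝ V)) (p : WeakDual ℝ V → ℝ) : Prop :=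
  memCusc K p ∧ (∃ ρ ∈ K, p ρ ≠ 0) ∧
  ∀ x, memCusc K x → (∀ ρ ∈ K, x ρ ≤ p ρ) →
    ∃ t : ℝ, 0 ≤ t ∧ t ≤ 1 ∧ ∀ ρ ∈ K, x ρ = t * p ρ

/-- The cone `C_usc` over the state space `K` is strongly atomic: each of its
members is the least upper bound of the extremal vectors it dominates. -/
def StronglyAtomicCusc (K : Set (WeakDual ℝ V)) : Prop :=
  ∀ g, memCusc K g →
    (∀ p, IsExtremalCusc K p → (∀ ρ ∈ K, p ρ ≤ g ρ) → ∀ ρ ∈ K, p ρ ≤ g ρ) ∧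
    (∀ h, memCusc K h →
      (∀ p, IsExtremalCusc K p → (∀ ρ ∈ K, p ρ ≤ g ρ) → ∀ ρ ∈ K, p ρ ≤ h ρ) →
      ∀ ρ ∈ K, g ρ ≤ h ρ)

end Defs


section StateSpace

variable {V : Type*} [NormedAddCommGroup V] [NormedSpace ℝ V] {P : Set V} {v : V}

namespace IsOrderUnitSpace

theorem zero_mem (hV : IsOrderUnitSpace V P v) : (0 : V) ∈ P := by
  simpa using hV.smul_mem 0 le_rfl v hV.unit_mem

theorem convex (hV : IsOrderUnitSpace V P v) : Convex ℝ P :=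
  fun x hx y hy a b ha hb _ => hV.add_mem _ (hV.smul_mem a ha x hx) _ (hV.smul_mem b hb y hy)

theorem norm_smul_sub_mem (hV : IsOrderUnitSpace V P v) (x : V) : ‖x‖ • v - x ∈ P := by
  have key : ∀ r : ℝ, ‖x‖ < r → r • v - x ∈ P := by
    intro r hr
    rw [hV.norm_eq x] at hr
    have hne : {r : ℝ | 0 ≤ r ∧ x + r • v ∈ P ∧ r • v - x ∈ P}.Nonempty := by
      obtain ⟨s, hs, hs'⟩ := hV.unit_order x
      obtain ⟨t, ht, ht'⟩ := hV.unit_order (-x)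
      refine ⟨s + t, by positivity, ?_, ?_⟩
      · convert hV.add_mem _ ht' _ (hV.smul_mem s hs.le v hV.unit_mem) using 1
        module
      · convert hV.add_mem _ hs' _ (hV.smul_mem t ht.le v hV.unit_mem) using 1
        module
    obtain ⟨s, ⟨_, _, h⟩, hs⟩ := exists_lt_of_csInf_lt hne hr
    convert hV.add_mem _ h _ (hV.smul_mem (r - s) (by linarith) v hV.unit_mem) using 1
    module
  have := hV.archimedean (x - ‖x‖ • v) v fun r hr => by
    rcases hr.eq_or_lt with rfl | hr
    · simpa using hV.unit_mem
    · convert hV.smul_mem r hr.le _ (key (‖x‖ + 1 / r) (by simp [hr])) using 1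
      match_scalars <;> field_simp
      ring
  simpa using this

theorem isClosed (hV : IsOrderUnitSpace V P v) : IsClosed P := by
  refine isClosed_of_closure_subset fun x hx => ?_
  have := hV.archimedean (-x) v fun r hr => by
    obtain ⟨y, hy, hxy⟩ := Metric.mem_closure_iff.1 hx (1 / (r + 1)) (by positivity)
    have h1 : ‖r • (y - x)‖ ≤ 1 := by
      rw [norm_smul, Real.norm_of_nonneg hr, ← dist_eq_norm, dist_comm]
      calc r * dist x y ≤ r * (1 / (r + 1)) := by gcongr
        _ ≤ 1 := by rw [mul_one_div, div_le_one (by positivity)]; linarith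
    convert hV.add_mem _ (hV.add_mem _ (hV.norm_smul_sub_mem (r • (y - x)))
      _ (hV.smul_mem (1 - ‖r • (y - x)‖) (by linarith) v hV.unit_mem))
      _ (hV.smul_mem r hr y hy) using 1
    module
  simpa using this

theorem exists_state_neg (hV : IsOrderUnitSpace V P v) {x : V} (hx : x ∉ P) :
    ∃ ρ ∈ stateSpace P v, ρ x < 0 := by
  obtain ⟨f, u, hfx, hfP⟩ := geometric_hahn_banach_point_closed hV.convex hV.isClosed hx
  have hu : u < 0 := by simpa using hfP 0 hV.zero_mem
  have hpos : ∀ y ∈ P, 0 ≤ f y := by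
    intro y hy
    by_contra! hneg
    have := hfP ((u / f y) • y) (hV.smul_mem _ (div_nonneg_of_nonpos hu.le hneg.le) y hy)
    rw [map_smul, smul_eq_mul, div_mul_cancel₀ _ hneg.ne] at this
    exact this.false
  have hv : 0 < f v := by
    refine (hpos v hV.unit_mem).lt_of_ne fun h0 => ?_
    have := hpos _ (hV.norm_smul_sub_mem (-x))
    have h2 := hpos _ (hV.norm_smul_sub_mem x)
    simp only [map_sub, map_smul, ← h0, map_neg, smul_eq_mul] at this
    linarith
  refine ⟨StrongDual.toWeakDual ((f v)⁻¹ • f), ⟨fun y hy => ?_, ?_⟩, ?_⟩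
  · exact mul_nonneg (inv_nonneg.2 hv.le) (hpos y hy)
  · exact inv_mul_cancel₀ hv.ne'
  · exact mul_neg_of_pos_of_neg (inv_pos.2 hv) (hfx.trans hu)

theorem mem_iff (hV : IsOrderUnitSpace V P v) {x : V} :
    x ∈ P ↔ ∀ ρ ∈ stateSpace P v, 0 ≤ ρ x := by
  refine ⟨fun hx ρ hρ => hρ.1 x hx, fun h => ?_⟩
  by_contra hx
  obtain ⟨ρ, hρ, hlt⟩ := hV.exists_state_neg hx
  exact hlt.not_ge (h ρ hρ)

theorem sub_mem_iff (hV : IsOrderUnitSpace V P v) {x y : V} :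
    y - x ∈ P ↔ ∀ ρ ∈ stateSpace P v, ρ x ≤ ρ y := by
  simp [hV.mem_iff]

theorem eq_of_states (hV : IsOrderUnitSpace V P v) {x y : V}
    (h : ∀ ρ ∈ stateSpace P v, ρ x = ρ y) : x = y := by
  have h1 : x - y ∈ P := hV.sub_mem_iff.2 fun ρ hρ => (h ρ hρ).ge
  have h2 : y - x ∈ P := hV.sub_mem_iff.2 fun ρ hρ => (h ρ hρ).le
  exact sub_eq_zero.1 (hV.proper _ h1 (by simpa using h2))

theorem isCompact_stateSpace (hV : IsOrderUnitSpace V P v) : IsCompact (stateSpace P v) := by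
  refine (WeakDual.isCompact_closedBall (𝕜 := ℝ) (0 : StrongDual ℝ V) 1).of_isClosed_subset ?_ ?_
  · have : stateSpace P v = (⋂ x ∈ P, {ρ : WeakDual ℝ V | 0 ≤ ρ x}) ∩ {ρ | ρ v = 1} := by
      ext; simp [stateSpace]
    rw [this]
    exact (isClosed_biInter fun x _ => isClosed_le continuous_const
      (WeakDual.eval_continuous x)).inter (isClosed_eq (WeakDual.eval_continuous v)
        continuous_const)
  · intro ρ hρ
    rw [Set.mem_preimage, mem_closedBall_zero_iff]
    refine ContinuousLinearMap.opNorm_le_bound _ zero_le_one fun x => ?_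
    have h1 := hρ.1 _ (hV.norm_smul_sub_mem x)
    have h2 := hρ.1 _ (hV.norm_smul_sub_mem (-x))
    simp only [map_sub, map_smul, map_neg, norm_neg, hρ.2, smul_eq_mul] at h1 h2
    rw [WeakDual.toStrongDual_apply, Real.norm_eq_abs, abs_le]
    constructor <;> linarith

theorem mem_openCone_iff (hV : IsOrderUnitSpace V P v) {x : V} :
    x ∈ openCone P v ↔ ∀ ρ ∈ stateSpace P v, 0 < ρ x := by
  constructor
  · rintro ⟨ε, hε, h⟩ ρ hρ
    have := hρ.1 _ h
    simp only [map_sub, map_smul, hρ.2, smul_eq_mul] at this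
    linarith
  · intro h
    rcases (stateSpace P v).eq_empty_or_nonempty with he | hne
    · exact ⟨1, one_pos, hV.mem_iff.2 (by simp [he])⟩
    · obtain ⟨σ, hσ, hmin⟩ := hV.isCompact_stateSpace.exists_isMinOn hne
        (WeakDual.eval_continuous x).continuousOn
      refine ⟨σ x, h σ hσ, hV.mem_iff.2 fun ρ hρ => ?_⟩
      have : σ x ≤ ρ x := hmin hρ
      simp only [map_sub, map_smul, hρ.2, smul_eq_mul]
      linarith

theorem unit_mem_openCone (hV : IsOrderUnitSpace V P v) : v ∈ openCone P v :=
  hV.mem_openCone_iff.2 fun ρ hρ => by simp [hρ.2]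

end IsOrderUnitSpace

theorem convex_stateSpace : Convex ℝ (stateSpace P v) := by
  rintro ρ hρ σ hσ a b ha hb hab
  refine ⟨fun x hx => ?_, ?_⟩
  · change 0 ≤ a * ρ x + b * σ x
    have := hρ.1 x hx
    have := hσ.1 x hx
    positivity
  · change a * ρ v + b * σ v = 1
    rw [hρ.2, hσ.2]
    linarith

theorem memCusc.add {g h : WeakDual ℝ V → ℝ} {K : Set (WeakDual ℝ V)} (hg : memCusc K g)
    (hh : memCusc K h) : memCusc K (fun ρ => g ρ + h ρ) := by
  refine ⟨fun ρ hρ => add_nonneg (hg.1 ρ hρ) (hh.1 ρ hρ), fun ρ hρ σ hσ t h0 h1 => ?_,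
    hg.2.2.add hh.2.2⟩
  simp only [hg.2.1 ρ hρ σ hσ t h0 h1, hh.2.1 ρ hρ σ hσ t h0 h1]
  ring

theorem memCusc.const_mul {g : WeakDual ℝ V → ℝ} {K : Set (WeakDual ℝ V)} (hg : memCusc K g)
    {r : ℝ} (hr : 0 ≤ r) : memCusc K (fun ρ => r * g ρ) := by
  refine ⟨fun ρ hρ => mul_nonneg hr (hg.1 ρ hρ), fun ρ hρ σ hσ t h0 h1 => ?_, ?_⟩
  · simp only [hg.2.1 ρ hρ σ hσ t h0 h1]
    ring
  · have hm : Monotone fun s : ℝ => r * s := fun a b hab => mul_le_mul_of_nonneg_left hab hr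
    exact (continuous_const_mul r).comp_upperSemicontinuousOn hg.2.2 hm

theorem memCusc.add_eval {g : WeakDual ℝ V → ℝ} {K : Set (WeakDual ℝ V)} (hg : memCusc K g)
    (x : V) (hx : ∀ ρ ∈ K, 0 ≤ g ρ + ρ x) : memCusc K (fun ρ => g ρ + ρ x) := by
  refine ⟨hx, fun ρ hρ σ hσ t h0 h1 => ?_, hg.2.2.add
    (WeakDual.eval_continuous x).continuousOn.upperSemicontinuousOn⟩
  have : ((1 - t) • ρ + t • σ) x = (1 - t) * ρ x + t * σ x := rfl
  simp only [hg.2.1 ρ hρ σ hσ t h0 h1, this]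
  ring

theorem memCusc_eval {K : Set (WeakDual ℝ V)} (x : V) (hx : ∀ ρ ∈ K, 0 ≤ ρ x) :
    memCusc K (fun ρ => ρ x) :=
  ⟨hx, fun _ _ _ _ _ _ _ => rfl,
    (WeakDual.eval_continuous x).continuousOn.upperSemicontinuousOn⟩

instance WeakDual.instLocallyConvexSpaceReal : LocallyConvexSpace ℝ (WeakDual ℝ V) :=
  (WeakDual.withSeminorms (𝕜 := ℝ) (E := V)).toLocallyConvexSpace

/-- Continuous functionals on the weak-* dual are evaluations. -/
theorem WeakDual.exists_eq_eval (f : StrongDual ℝ (WeakDual ℝ V)) :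
    ∃ x : V, ∀ ρ : WeakDual ℝ V, f ρ = ρ x := by
  obtain ⟨x, hx⟩ := LinearMap.dualEmbedding_surjective (topDualPairing ℝ V) f
  exact ⟨x, fun ρ => by rw [← hx]; rfl⟩

/-- A compact convex set lying strictly above the hypograph of an upper semicontinuous affine
function on the state space can be separated from it by the graph of a vector. -/
theorem exists_vector_between (hV : IsOrderUnitSpace V P v) {g : WeakDual ℝ V → ℝ}
    (hg : memCusc (stateSpace P v) g) {B : Set (WeakDual ℝ V × ℝ)} (hBne : B.Nonempty)
    (hBconv : Convex ℝ B) (hBcomp : IsCompact B)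
    (hB : ∀ z ∈ B, z.1 ∈ stateSpace P v ∧ g z.1 < z.2) :
    ∃ c : V, (∀ ρ ∈ stateSpace P v, g ρ < ρ c) ∧ ∀ z ∈ B, z.1 c < z.2 := by
  have hAclosed := (upperSemicontinuousOn_iff_isClosed_hypograph
    hV.isCompact_stateSpace.isClosed).1 hg.2.2
  have hAconv : Convex ℝ {z : WeakDual ℝ V × ℝ | z.1 ∈ stateSpace P v ∧ z.2 ≤ g z.1} := by
    refine ConcaveOn.convex_hypograph ⟨convex_stateSpace, fun ρ hρ σ hσ a b ha hb hab => ?_⟩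
    obtain rfl : a = 1 - b := by linarith
    exact (hg.2.1 ρ hρ σ hσ b hb (by linarith)).ge
  obtain ⟨f, r, s, hfB, hrs, hfA⟩ := geometric_hahn_banach_compact_closed hBconv hBcomp
    hAconv hAclosed (Set.disjoint_left.2 fun z hz hz' => (hB z hz).2.not_ge hz'.2)
  obtain ⟨x, hx⟩ := WeakDual.exists_eq_eval (f.comp (ContinuousLinearMap.inl ℝ _ ℝ))
  set α := f (0, 1) with hα
  have hf : ∀ ρ t, f (ρ, t) = ρ x + t * α := by
    intro ρ t
    have h1 : ((ρ, t) : WeakDual ℝ V × ℝ) = (ρ, 0) + t • ((0, 1) : WeakDual ℝ V × ℝ) := by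
      ext <;> simp
    rw [h1, map_add, map_smul, smul_eq_mul, ← hx ρ]
    rfl
  have hαneg : α < 0 := by
    obtain ⟨⟨ρ, t⟩, hz⟩ := hBne
    have h1 := hfB _ hz
    have h2 := hfA (ρ, g ρ) ⟨(hB _ hz).1, le_rfl⟩
    rw [hf] at h1 h2
    have h3 : g ρ < t := (hB _ hz).2
    nlinarith
  have hc : ∀ ρ ∈ stateSpace P v, ρ (α⁻¹ • (s • v - x)) * α = s - ρ x := by
    intro ρ hρ
    simp only [map_smul, map_sub, hρ.2, smul_eq_mul]
    have := hαneg.ne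
    field_simp
  refine ⟨α⁻¹ • (s • v - x), fun ρ hρ => ?_, fun z hz => ?_⟩
  · have h1 := hfA (ρ, g ρ) ⟨hρ, le_rfl⟩
    rw [hf] at h1
    have := hc ρ hρ
    nlinarith
  · have h1 := hfB z hz
    rw [show z = (z.1, z.2) from rfl, hf] at h1
    have := hc z.1 (hB z hz).1
    nlinarith

/-- The vectors lying strictly above `g` on the state space. -/
def strictUpper (P : Set V) (v : V) (g : WeakDual ℝ V → ℝ) : Set V :=
  {a | ∀ ρ ∈ stateSpace P v, g ρ < ρ a}

theorem strictUpper_subset (hV : IsOrderUnitSpace V P v) {g : WeakDual ℝ V → ℝ}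
    (hg : memCusc (stateSpace P v) g) : strictUpper P v g ⊆ openCone P v :=
  fun _ ha => hV.mem_openCone_iff.2 fun ρ hρ => (hg.1 ρ hρ).trans_lt (ha ρ hρ)

theorem strictUpper_nonempty (hV : IsOrderUnitSpace V P v) {g : WeakDual ℝ V → ℝ}
    (hg : memCusc (stateSpace P v) g) : (strictUpper P v g).Nonempty := by
  obtain ⟨M, hM⟩ := hg.2.2.bddAbove_of_isCompact hV.isCompact_stateSpace
  refine ⟨(M + 1) • v, fun ρ hρ => ?_⟩
  have := hM ⟨ρ, hρ, rfl⟩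
  simp only [map_smul, hρ.2, smul_eq_mul]
  linarith

theorem exists_strictUpper_lt (hV : IsOrderUnitSpace V P v) {g : WeakDual ℝ V → ℝ}
    (hg : memCusc (stateSpace P v) g) {ρ : WeakDual ℝ V} (hρ : ρ ∈ stateSpace P v) {r : ℝ}
    (hr : g ρ < r) : ∃ a ∈ strictUpper P v g, ρ a < r := by
  obtain ⟨c, hc, hc'⟩ := exists_vector_between hV hg (Set.singleton_nonempty (ρ, r))
    (convex_singleton _) isCompact_singleton (by simpa using ⟨hρ, hr⟩)
  exact ⟨c, hc, hc' _ rfl⟩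

theorem strictUpper_directed (hV : IsOrderUnitSpace V P v) {g : WeakDual ℝ V → ℝ}
    (hg : memCusc (stateSpace P v) g) {a b : V} (ha : a ∈ strictUpper P v g)
    (hb : b ∈ strictUpper P v g) :
    ∃ c ∈ strictUpper P v g, a - c ∈ P ∧ b - c ∈ P := by
  rcases (stateSpace P v).eq_empty_or_nonempty with he | ⟨ρ₀, hρ₀⟩
  · exact ⟨a, ha, by simpa using hV.zero_mem, hV.mem_iff.2 (by simp [he])⟩
  let F : ℝ × WeakDual ℝ V × WeakDual ℝ V → WeakDual ℝ V × ℝ := fun z =>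
    ((1 - z.1) • z.2.1 + z.1 • z.2.2, (1 - z.1) * z.2.1 a + z.1 * z.2.2 b)
  let G : V → Set (WeakDual ℝ V × ℝ) := fun x =>
    (fun ρ : WeakDual ℝ V => (ρ, ρ x)) '' stateSpace P v
  have hG : ∀ x, Convex ℝ (G x) := by
    rintro x _ ⟨ρ, hρ, rfl⟩ _ ⟨σ, hσ, rfl⟩ s t hs ht hst
    exact ⟨s • ρ + t • σ, convex_stateSpace hρ hσ hs ht hst, rfl⟩
  have hF : F '' (Set.Icc 0 1 ×ˢ stateSpace P v ×ˢ stateSpace P v) = convexJoin ℝ (G a) (G b) := by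
    ext z
    simp only [mem_convexJoin, segment_eq_image, G, F]
    constructor
    · rintro ⟨⟨t, ρ, σ⟩, ⟨ht, hρ, hσ⟩, rfl⟩
      exact ⟨_, ⟨ρ, hρ, rfl⟩, _, ⟨σ, hσ, rfl⟩, t, ht, rfl⟩
    · rintro ⟨_, ⟨ρ, hρ, rfl⟩, _, ⟨σ, hσ, rfl⟩, t, ht, rfl⟩
      exact ⟨⟨t, ρ, σ⟩, ⟨ht, hρ, hσ⟩, rfl⟩
  have hFcont : Continuous F := by
    have h1 : Continuous fun z : ℝ × WeakDual ℝ V × WeakDual ℝ V => z.2.1 a :=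
      (WeakDual.eval_continuous a).comp (by fun_prop)
    have h2 : Continuous fun z : ℝ × WeakDual ℝ V × WeakDual ℝ V => z.2.2 b :=
      (WeakDual.eval_continuous b).comp (by fun_prop)
    simp only [F]
    fun_prop
  obtain ⟨c, hc, hc'⟩ := exists_vector_between hV hg (B := convexJoin ℝ (G a) (G b))
    (by rw [← hF]; exact ⟨_, ⟨(0, ρ₀, ρ₀), ⟨by simp, hρ₀, hρ₀⟩, rfl⟩⟩)
    ((hG a).convexJoin (hG b))
    (by
      rw [← hF]
      exact (isCompact_Icc.prod (hV.isCompact_stateSpace.prod hV.isCompact_stateSpace)).image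
        hFcont)
    (by
      rw [← hF]
      rintro _ ⟨⟨t, ρ, σ⟩, ⟨ht, hρ, hσ⟩, rfl⟩
      refine ⟨convex_stateSpace hρ hσ (sub_nonneg.2 ht.2) ht.1 (by simp), ?_⟩
      simp only [F]
      have h1 := ha ρ hρ
      have h2 := hb σ hσ
      rw [hg.2.1 ρ hρ σ hσ t ht.1 ht.2]
      rcases ht.1.eq_or_lt with h0 | h0
      · simp only at h0
        subst h0
        simpa using h1
      · have := mul_le_mul_of_nonneg_left h1.le (sub_nonneg.2 ht.2)
        have := mul_lt_mul_of_pos_left h2 h0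
        simp only at *
        linarith)
  refine ⟨c, hc, hV.sub_mem_iff.2 fun ρ hρ => (hc' (ρ, ρ a) ?_).le,
    hV.sub_mem_iff.2 fun ρ hρ => (hc' (ρ, ρ b) ?_).le⟩
  · exact mem_convexJoin.2 ⟨_, ⟨ρ, hρ, rfl⟩, _, ⟨ρ, hρ, rfl⟩, left_mem_segment _ _ _⟩
  · exact mem_convexJoin.2 ⟨_, ⟨ρ, hρ, rfl⟩, _, ⟨ρ, hρ, rfl⟩, right_mem_segment _ _ _⟩

/-- A vector strictly above `g` stays so after being scaled down slightly. -/
theorem exists_smul_mem_strictUpper (hV : IsOrderUnitSpace V P v) {g : WeakDual ℝ V → ℝ}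
    (hg : memCusc (stateSpace P v) g) {a : V} (ha : a ∈ strictUpper P v g) :
    ∃ r : ℝ, 0 < r ∧ r < 1 ∧ r • a ∈ strictUpper P v g := by
  rcases (stateSpace P v).eq_empty_or_nonempty with he | hne
  · exact ⟨1 / 2, by norm_num, by norm_num, fun ρ hρ => by simp [he] at hρ⟩
  obtain ⟨σ, hσ, hmax⟩ := UpperSemicontinuousOn.exists_isMaxOn (f := fun ρ => g ρ + ρ (-a)) hne
    hV.isCompact_stateSpace (hg.2.2.add
      (WeakDual.eval_continuous (-a)).continuousOn.upperSemicontinuousOn)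
  have hδ : 0 < σ a - g σ := sub_pos.2 (ha σ hσ)
  obtain ⟨N, hN, hNa⟩ := hV.unit_order a
  set δ := σ a - g σ with hδdef
  refine ⟨N / (N + δ), by positivity, (div_lt_one (by positivity)).2 (by linarith),
    fun ρ hρ => ?_⟩
  have h1 : g ρ + ρ (-a) ≤ g σ + σ (-a) := hmax hρ
  have h2 := hρ.1 _ hNa
  simp only [map_sub, map_neg, map_smul, hρ.2, smul_eq_mul] at h1 h2 ⊢
  rw [div_mul_eq_mul_div, lt_div_iff₀ (by positivity)]
  have h3 := hg.1 ρ hρ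
  nlinarith

end StateSpace

section CuscExtension

variable {V : Type*} [NormedAddCommGroup V] [NormedSpace ℝ V] {P : Set V} {v : V}
variable {W : Type*} [NormedAddCommGroup W] [NormedSpace ℝ W] {Q : Set W} {w : W}

theorem smul_mem_openCone (hV : IsOrderUnitSpace V P v) {x : V} (hx : x ∈ openCone P v) {r : ℝ}
    (hr : 0 < r) : r • x ∈ openCone P v :=
  hV.mem_openCone_iff.2 fun ρ hρ => by
    simpa using mul_pos hr (hV.mem_openCone_iff.1 hx ρ hρ)

theorem add_mem_openCone (hV : IsOrderUnitSpace V P v) {x y : V} (hx : x ∈ openCone P v)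
    (hy : y ∈ openCone P v) : x + y ∈ openCone P v :=
  hV.mem_openCone_iff.2 fun ρ hρ => by
    simpa using add_pos (hV.mem_openCone_iff.1 hx ρ hρ) (hV.mem_openCone_iff.1 hy ρ hρ)

theorem GaugePreserving.invFunOn (hV : IsOrderUnitSpace V P v) {Ψ : V → W}
    (hΨ : GaugePreserving P v Q w Ψ) :
    GaugePreserving Q w P v (Function.invFunOn Ψ (openCone P v)) := by
  have hinv : Set.InvOn (Function.invFunOn Ψ (openCone P v)) Ψ (openCone P v) (openCone Q w) :=
    hΨ.1.invOn_invFunOn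
  have hbij := hinv.symm.bijOn hΨ.1.surjOn.mapsTo_invFunOn hΨ.1.mapsTo
  refine ⟨hbij, fun x hx r hr => ?_, fun x hx y hy => ?_⟩
  · have hx' := hbij.mapsTo hx
    conv_lhs => rw [← hinv.2 hx]
    rw [← hΨ.2.1 _ hx' r hr]
    exact hinv.1 (smul_mem_openCone hV hx' hr)
  · rw [hΨ.2.2 _ (hbij.mapsTo hx) _ (hbij.mapsTo hy), hinv.2 hx, hinv.2 hy]

/-- The extension of a map between open cones to upper semicontinuous affine functions. -/
noncomputable def cuscExt (P : Set V) (v : V) (Ψ : V → W) (g : WeakDual ℝ V → ℝ) :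
    WeakDual ℝ W → ℝ :=
  fun σ => sInf ((fun a => σ (Ψ a)) '' strictUpper P v g)

theorem strictUpper_eval_sInf (hV : IsOrderUnitSpace V P v) {g : WeakDual ℝ V → ℝ}
    (hg : memCusc (stateSpace P v) g) {ρ : WeakDual ℝ V} (hρ : ρ ∈ stateSpace P v) :
    sInf ((fun a => ρ a) '' strictUpper P v g) = g ρ := by
  refine IsGLB.csInf_eq ⟨?_, fun r hr => ?_⟩ ((strictUpper_nonempty hV hg).image _)
  · rintro _ ⟨a, ha, rfl⟩
    exact (ha ρ hρ).le
  · by_contra! h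
    obtain ⟨a, ha, hlt⟩ := exists_strictUpper_lt hV hg hρ h
    exact hlt.not_ge (hr ⟨a, ha, rfl⟩)

variable {Ψ : V → W}

theorem cuscExt_le (hV : IsOrderUnitSpace V P v) (hW : IsOrderUnitSpace W Q w)
    (hΨ : GaugePreserving P v Q w Ψ) {g : WeakDual ℝ V → ℝ} (hg : memCusc (stateSpace P v) g)
    {σ : WeakDual ℝ W} (hσ : σ ∈ stateSpace Q w) {a : V} (ha : a ∈ strictUpper P v g) :
    cuscExt P v Ψ g σ ≤ σ (Ψ a) := by
  refine csInf_le ⟨0, ?_⟩ ⟨a, ha, rfl⟩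
  rintro _ ⟨b, hb, rfl⟩
  exact (hW.mem_openCone_iff.1 (hΨ.1.mapsTo (strictUpper_subset hV hg hb)) σ hσ).le

theorem le_cuscExt (hV : IsOrderUnitSpace V P v) {g : WeakDual ℝ V → ℝ}
    (hg : memCusc (stateSpace P v) g) {σ : WeakDual ℝ W} {r : ℝ}
    (h : ∀ a ∈ strictUpper P v g, r ≤ σ (Ψ a)) : r ≤ cuscExt P v Ψ g σ := by
  refine le_csInf ((strictUpper_nonempty hV hg).image _) ?_
  rintro _ ⟨a, ha, rfl⟩
  exact h a ha

theorem exists_lt_of_cuscExt_lt (hV : IsOrderUnitSpace V P v) {g : WeakDual ℝ V → ℝ}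
    (hg : memCusc (stateSpace P v) g) {σ : WeakDual ℝ W} {r : ℝ}
    (h : cuscExt P v Ψ g σ < r) : ∃ a ∈ strictUpper P v g, σ (Ψ a) < r := by
  by_contra! hcon
  exact (le_cuscExt hV hg hcon).not_gt h

theorem exists_directed_image (hV : IsOrderUnitSpace V P v) (hW : IsOrderUnitSpace W Q w)
    (hΨ : GaugePreserving P v Q w Ψ) {g : WeakDual ℝ V → ℝ} (hg : memCusc (stateSpace P v) g)
    {a b : V} (ha : a ∈ strictUpper P v g) (hb : b ∈ strictUpper P v g) :
    ∃ c ∈ strictUpper P v g, (∀ σ ∈ stateSpace Q w, σ (Ψ c) ≤ σ (Ψ a)) ∧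
      ∀ σ ∈ stateSpace Q w, σ (Ψ c) ≤ σ (Ψ b) := by
  obtain ⟨c, hc, hca, hcb⟩ := strictUpper_directed hV hg ha hb
  have hC := strictUpper_subset hV hg
  exact ⟨c, hc, hW.sub_mem_iff.1 ((hΨ.2.2 _ (hC hc) _ (hC ha)).1 hca),
    hW.sub_mem_iff.1 ((hΨ.2.2 _ (hC hc) _ (hC hb)).1 hcb)⟩

theorem memCusc_cuscExt (hV : IsOrderUnitSpace V P v) (hW : IsOrderUnitSpace W Q w)
    (hΨ : GaugePreserving P v Q w Ψ) {g : WeakDual ℝ V → ℝ}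
    (hg : memCusc (stateSpace P v) g) : memCusc (stateSpace Q w) (cuscExt P v Ψ g) := by
  refine ⟨fun σ hσ => le_cuscExt hV hg fun a ha =>
    (hW.mem_openCone_iff.1 (hΨ.1.mapsTo (strictUpper_subset hV hg ha)) σ hσ).le,
    fun σ hσ τ hτ t h0 h1 => ?_, ?_⟩
  · have hmix : ∀ y : W, ((1 - t) • σ + t • τ) y = (1 - t) * σ y + t * τ y := fun _ => rfl
    apply le_antisymm
    · refine le_of_forall_pos_le_add fun ε hε => ?_
      obtain ⟨a, ha, hlta⟩ := exists_lt_of_cuscExt_lt hV hg (lt_add_of_pos_right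
        (cuscExt P v Ψ g σ) hε)
      obtain ⟨b, hb, hltb⟩ := exists_lt_of_cuscExt_lt hV hg (lt_add_of_pos_right
        (cuscExt P v Ψ g τ) hε)
      obtain ⟨c, hc, hca, hcb⟩ := exists_directed_image hV hW hΨ hg ha hb
      have h := cuscExt_le hV hW hΨ hg
        (convex_stateSpace hσ hτ (sub_nonneg.2 h1) h0 (by simp)) hc
      rw [hmix] at h
      have := mul_le_mul_of_nonneg_left ((hca σ hσ).trans hlta.le) (sub_nonneg.2 h1)
      have := mul_le_mul_of_nonneg_left ((hcb τ hτ).trans hltb.le) h0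
      linarith
    · refine le_cuscExt hV hg fun a ha => ?_
      rw [hmix]
      have := mul_le_mul_of_nonneg_left (cuscExt_le hV hW hΨ hg hσ ha) (sub_nonneg.2 h1)
      have := mul_le_mul_of_nonneg_left (cuscExt_le hV hW hΨ hg hτ ha) h0
      linarith
  · refine upperSemicontinuousOn_iff.2 fun σ hσ => upperSemicontinuousWithinAt_iff.2 fun r hr => ?_
    obtain ⟨a, ha, hlt⟩ := exists_lt_of_cuscExt_lt hV hg hr
    filter_upwards [self_mem_nhdsWithin, mem_nhdsWithin_of_mem_nhds
      ((isOpen_lt (WeakDual.eval_continuous (Ψ a)) continuous_const).mem_nhds hlt)] with τ hτ hτ'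
    exact (cuscExt_le hV hW hΨ hg hτ ha).trans_lt hτ'

theorem strictUpper_cuscExt (hV : IsOrderUnitSpace V P v) (hW : IsOrderUnitSpace W Q w)
    (hΨ : GaugePreserving P v Q w Ψ) {g : WeakDual ℝ V → ℝ}
    (hg : memCusc (stateSpace P v) g) :
    strictUpper Q w (cuscExt P v Ψ g) = Ψ '' strictUpper P v g := by
  have hC := strictUpper_subset hV hg
  apply Set.Subset.antisymm
  · intro b hb
    obtain ⟨x, hx, rfl⟩ := hΨ.1.surjOn (strictUpper_subset hW (memCusc_cuscExt hV hW hΨ hg) hb)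
    refine ⟨x, ?_, rfl⟩
    obtain ⟨a₀, ha₀⟩ := strictUpper_nonempty hV hg
    have : Nonempty (strictUpper P v g) := ⟨⟨a₀, ha₀⟩⟩
    let U : strictUpper P v g → Set (stateSpace Q w) := fun a => {σ | σ.1 (Ψ a) < σ.1 (Ψ x)}
    have hcont : ∀ y : W, Continuous fun σ : stateSpace Q w => σ.1 y := fun y =>
      (WeakDual.eval_continuous y).comp continuous_subtype_val
    have : CompactSpace (stateSpace Q w) := isCompact_iff_compactSpace.1 hW.isCompact_stateSpace
    obtain ⟨a, ha⟩ := isCompact_univ.elim_directed_cover U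
      (fun a => isOpen_lt (hcont _) (hcont _))
      (fun σ _ => by
        obtain ⟨a, ha, hlt⟩ := exists_lt_of_cuscExt_lt hV hg (hb σ.1 σ.2)
        exact Set.mem_iUnion.2 ⟨⟨a, ha⟩, hlt⟩)
      (fun a b => by
        obtain ⟨c, hc, hca, hcb⟩ := exists_directed_image hV hW hΨ hg a.2 b.2
        exact ⟨⟨c, hc⟩, fun σ (hσ : _ < _) => (hca σ.1 σ.2).trans_lt hσ,
          fun σ (hσ : _ < _) => (hcb σ.1 σ.2).trans_lt hσ⟩)
    have hle : x - a ∈ P := (hΨ.2.2 _ (hC a.2) _ hx).2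
      (hW.sub_mem_iff.2 fun σ hσ => (ha (Set.mem_univ (⟨σ, hσ⟩ : stateSpace Q w))).le)
    exact fun ρ hρ => (a.2 ρ hρ).trans_le (hV.sub_mem_iff.1 hle ρ hρ)
  · rintro _ ⟨a, ha, rfl⟩ σ hσ
    obtain ⟨r, h0, h1, hr⟩ := exists_smul_mem_strictUpper hV hg ha
    have h := cuscExt_le hV hW hΨ hg hσ hr
    rw [hΨ.2.1 a (hC ha) r h0, map_smul, smul_eq_mul] at h
    have := hW.mem_openCone_iff.1 (hΨ.1.mapsTo (hC ha)) σ hσ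
    nlinarith

theorem cuscExt_mono (hV : IsOrderUnitSpace V P v) (hW : IsOrderUnitSpace W Q w)
    (hΨ : GaugePreserving P v Q w Ψ) {g h : WeakDual ℝ V → ℝ} (hg : memCusc (stateSpace P v) g)
    (hh : memCusc (stateSpace P v) h) (hgh : ∀ ρ ∈ stateSpace P v, g ρ ≤ h ρ) :
    ∀ σ ∈ stateSpace Q w, cuscExt P v Ψ g σ ≤ cuscExt P v Ψ h σ :=
  fun _ hσ => le_cuscExt hV hh fun _ ha => cuscExt_le hV hW hΨ hg hσ
    fun ρ hρ => (hgh ρ hρ).trans_lt (ha ρ hρ)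

theorem cuscExt_congr (hV : IsOrderUnitSpace V P v) (hW : IsOrderUnitSpace W Q w)
    (hΨ : GaugePreserving P v Q w Ψ) {g h : WeakDual ℝ V → ℝ} (hg : memCusc (stateSpace P v) g)
    (hh : memCusc (stateSpace P v) h) (hgh : ∀ ρ ∈ stateSpace P v, g ρ = h ρ) :
    ∀ σ ∈ stateSpace Q w, cuscExt P v Ψ g σ = cuscExt P v Ψ h σ := fun σ hσ =>
  le_antisymm (cuscExt_mono hV hW hΨ hg hh (fun ρ hρ => (hgh ρ hρ).le) σ hσ)
    (cuscExt_mono hV hW hΨ hh hg (fun ρ hρ => (hgh ρ hρ).ge) σ hσ)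

theorem le_of_cuscExt_le (hV : IsOrderUnitSpace V P v) (hW : IsOrderUnitSpace W Q w)
    (hΨ : GaugePreserving P v Q w Ψ) {g h : WeakDual ℝ V → ℝ} (hg : memCusc (stateSpace P v) g)
    (hh : memCusc (stateSpace P v) h)
    (hgh : ∀ σ ∈ stateSpace Q w, cuscExt P v Ψ g σ ≤ cuscExt P v Ψ h σ) :
    ∀ ρ ∈ stateSpace P v, g ρ ≤ h ρ := by
  have hsub : strictUpper P v h ⊆ strictUpper P v g := by
    intro a ha
    have h1 : Ψ a ∈ strictUpper Q w (cuscExt P v Ψ h) := by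
      rw [strictUpper_cuscExt hV hW hΨ hh]
      exact ⟨a, ha, rfl⟩
    have h2 : Ψ a ∈ strictUpper Q w (cuscExt P v Ψ g) :=
      fun σ hσ => (hgh σ hσ).trans_lt (h1 σ hσ)
    rw [strictUpper_cuscExt hV hW hΨ hg] at h2
    obtain ⟨b, hb, hba⟩ := h2
    rwa [← hΨ.1.injOn (strictUpper_subset hV hg hb) (strictUpper_subset hV hh ha) hba]
  intro ρ hρ
  by_contra! hlt
  obtain ⟨a, ha, hlt'⟩ := exists_strictUpper_lt hV hh hρ hlt
  exact (hsub ha ρ hρ).not_gt hlt'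

theorem exists_cuscExt_eq (hV : IsOrderUnitSpace V P v) (hW : IsOrderUnitSpace W Q w)
    (hΨ : GaugePreserving P v Q w Ψ) {h : WeakDual ℝ W → ℝ} (hh : memCusc (stateSpace Q w) h) :
    ∃ g, memCusc (stateSpace P v) g ∧ ∀ σ ∈ stateSpace Q w, cuscExt P v Ψ g σ = h σ := by
  have hΦ := hΨ.invFunOn hV
  refine ⟨_, memCusc_cuscExt hW hV hΦ hh, fun σ hσ => ?_⟩
  rw [cuscExt, strictUpper_cuscExt hW hV hΦ hh, Set.image_image, ← strictUpper_eval_sInf hW hh hσ]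
  congr 1
  refine Set.image_congr fun b hb => ?_
  rw [hΨ.1.invOn_invFunOn.2 (strictUpper_subset hW hh hb)]

theorem cuscExt_smul (hV : IsOrderUnitSpace V P v) (hW : IsOrderUnitSpace W Q w)
    (hΨ : GaugePreserving P v Q w Ψ) {g : WeakDual ℝ V → ℝ} (hg : memCusc (stateSpace P v) g)
    {r : ℝ} (hr : 0 < r) :
    ∀ σ ∈ stateSpace Q w, cuscExt P v Ψ (fun ρ => r * g ρ) σ = r * cuscExt P v Ψ g σ := by
  intro σ hσ
  have hmem : ∀ a, r • a ∈ strictUpper P v (fun ρ => r * g ρ) ↔ a ∈ strictUpper P v g := by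
    intro a
    simp only [strictUpper, Set.mem_ofPred_eq, map_smul, smul_eq_mul]
    exact forall₂_congr fun ρ _ => mul_lt_mul_iff_right₀ hr
  have hgr := hg.const_mul hr.le
  apply le_antisymm
  · rw [← div_le_iff₀' hr]
    refine le_cuscExt hV hg fun a ha => ?_
    rw [div_le_iff₀' hr]
    have := cuscExt_le hV hW hΨ hgr hσ ((hmem a).2 ha)
    rwa [hΨ.2.1 a (strictUpper_subset hV hg ha) r hr, map_smul, smul_eq_mul] at this
  · refine le_cuscExt hV hgr fun a ha => ?_
    have ha' : r⁻¹ • a ∈ strictUpper P v g := (hmem _).1 (by rwa [smul_inv_smul₀ hr.ne'])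
    have := cuscExt_le hV hW hΨ hg hσ ha'
    rwa [hΨ.2.1 a (strictUpper_subset hV hgr ha) _ (inv_pos.2 hr), map_smul, smul_eq_mul,
      le_inv_mul_iff₀ hr] at this

theorem memCusc_of_mem_openCone (hV : IsOrderUnitSpace V P v) {x : V} (hx : x ∈ openCone P v) :
    memCusc (stateSpace P v) (fun ρ => ρ x) :=
  memCusc_eval x fun ρ hρ => (hV.mem_openCone_iff.1 hx ρ hρ).le

theorem cuscExt_eval (hV : IsOrderUnitSpace V P v) (hW : IsOrderUnitSpace W Q w)
    (hΨ : GaugePreserving P v Q w Ψ) {x : V} (hx : x ∈ openCone P v) :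
    ∀ σ ∈ stateSpace Q w, cuscExt P v Ψ (fun ρ => ρ x) σ = σ (Ψ x) := by
  intro σ hσ
  have hg := memCusc_of_mem_openCone hV hx
  apply le_antisymm
  · refine le_of_forall_pos_le_add fun ε hε => ?_
    have hpos := hW.mem_openCone_iff.1 (hΨ.1.mapsTo hx) σ hσ
    have hδ : 0 < ε / σ (Ψ x) := by positivity
    have h := cuscExt_le hV hW hΨ hg hσ (a := (1 + ε / σ (Ψ x)) • x) fun ρ hρ => by
      have := mul_pos hδ (hV.mem_openCone_iff.1 hx ρ hρ)
      simp only [map_smul, smul_eq_mul]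
      linarith
    rw [hΨ.2.1 x hx _ (by positivity), map_smul, smul_eq_mul] at h
    calc _ ≤ _ := h
      _ = _ := by field_simp
  · refine le_cuscExt hV hg fun a ha => ?_
    exact hW.sub_mem_iff.1 ((hΨ.2.2 x hx a (strictUpper_subset hV hg ha)).1
      (hV.sub_mem_iff.2 fun ρ hρ => (ha ρ hρ).le)) σ hσ

end CuscExtension

section Additivity

theorem le_of_gauge_le {ι : Type*} {K : Set ι} {x p : ι → ℝ} (hx : ∀ i ∈ K, 0 < x i)
    (hp : ∀ i ∈ K, 0 ≤ p i) (hp0 : ∃ i ∈ K, p i ≠ 0)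
    (hbdd : ∃ N : ℝ, 0 ≤ N ∧ ∀ i ∈ K, p i ≤ N * x i) {r s : ℝ} (hs : 0 ≤ s)
    (h : ∀ l : ℝ, 0 ≤ l → (∀ i ∈ K, s * p i ≤ l * x i) → ∀ i ∈ K, r * p i ≤ l * x i) :
    r ≤ s := by
  by_contra! hsr
  have hr : 0 < r := hs.trans_lt hsr
  set S : Set ℝ := {l | 0 ≤ l ∧ ∀ i ∈ K, p i ≤ l * x i} with hS
  have hbelow : BddBelow S := ⟨0, fun l hl => hl.1⟩
  have hM : ∀ i ∈ K, p i ≤ sInf S * x i := fun i hi => by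
    rw [← div_le_iff₀ (hx i hi)]
    exact le_csInf hbdd fun l hl => (div_le_iff₀ (hx i hi)).2 (hl.2 i hi)
  have hM0 : 0 < sInf S := by
    obtain ⟨i, hi, hne⟩ := hp0
    have h1 := (hp i hi).lt_of_ne' hne
    exact pos_of_mul_pos_left (h1.trans_le (hM i hi)) (hx i hi).le
  have hmem : s * sInf S / r ∈ S := by
    refine ⟨by positivity, fun i hi => ?_⟩
    have := h (s * sInf S) (by positivity) (fun j hj => by
      rw [mul_assoc]
      exact mul_le_mul_of_nonneg_left (hM j hj) hs) i hi
    rw [div_mul_eq_mul_div, le_div_iff₀ hr]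
    linarith
  have hle := csInf_le hbelow hmem
  rw [le_div_iff₀ hr] at hle
  nlinarith

variable {V : Type*} [NormedAddCommGroup V] [NormedSpace ℝ V] {P : Set V} {v : V}
variable {W : Type*} [NormedAddCommGroup W] [NormedSpace ℝ W] {Q : Set W} {w : W}
variable {Ψ : V → W}

theorem exists_le_mul_eval (hV : IsOrderUnitSpace V P v) {g : WeakDual ℝ V → ℝ}
    (hg : memCusc (stateSpace P v) g) {x : V} (hx : x ∈ openCone P v) :
    ∃ N : ℝ, 0 ≤ N ∧ ∀ ρ ∈ stateSpace P v, g ρ ≤ N * ρ x := by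
  obtain ⟨ε, hε, hεx⟩ := hx
  obtain ⟨a, ha⟩ := strictUpper_nonempty hV hg
  obtain ⟨M, hM, hMa⟩ := hV.unit_order a
  refine ⟨M / ε, by positivity, fun ρ hρ => ?_⟩
  have h1 := hρ.1 _ hεx
  have h2 := hρ.1 _ hMa
  simp only [map_sub, map_smul, hρ.2, smul_eq_mul] at h1 h2
  have h3 := ha ρ hρ
  rw [div_mul_eq_mul_div, le_div_iff₀ hε]
  nlinarith

/-- The extension is affine on the segment from `x` to `x + p` when `p` is extremal. -/
theorem cuscExt_eval_add_mul_extremal (hV : IsOrderUnitSpace V P v)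
    (hW : IsOrderUnitSpace W Q w) (hΨ : GaugePreserving P v Q w Ψ) {x : V}
    (hx : x ∈ openCone P v) {p : WeakDual ℝ V → ℝ} (hp : IsExtremalCusc (stateSpace P v) p)
    {s : ℝ} (hs0 : 0 < s) (hs1 : s ≤ 1) :
    ∀ σ ∈ stateSpace Q w, cuscExt P v Ψ (fun ρ => ρ x + s * p ρ) σ =
      (1 - s) * σ (Ψ x) + s * cuscExt P v Ψ (fun ρ => ρ x + p ρ) σ := by
  obtain ⟨hpc, hp0, hpext⟩ := hp
  have hxpos := hV.mem_openCone_iff.1 hx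
  have hxc := memCusc_of_mem_openCone hV hx
  have hΨx := hΨ.1.mapsTo hx
  have hqc := hxc.add hpc
  have hFq := memCusc_cuscExt hV hW hΨ hqc
  have hFx := cuscExt_eval hV hW hΨ hx
  have hzc := ((memCusc_of_mem_openCone hW hΨx).const_mul (sub_nonneg.2 hs1)).add
    (hFq.const_mul hs0.le)
  obtain ⟨g, hg, hgz⟩ := exists_cuscExt_eq hV hW hΨ hzc
  have hxq : ∀ σ ∈ stateSpace Q w, σ (Ψ x) ≤ cuscExt P v Ψ (fun ρ => ρ x + p ρ) σ := by
    intro σ hσ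
    rw [← hFx σ hσ]
    exact cuscExt_mono hV hW hΨ hxc hqc (fun ρ hρ => by simpa using hpc.1 ρ hρ) σ hσ
  have hxg : ∀ ρ ∈ stateSpace P v, ρ x ≤ g ρ := by
    refine le_of_cuscExt_le hV hW hΨ hxc hg fun σ hσ => ?_
    rw [hFx σ hσ, hgz σ hσ]
    nlinarith [hxq σ hσ]
  have hgq : ∀ ρ ∈ stateSpace P v, g ρ ≤ ρ x + p ρ := by
    refine le_of_cuscExt_le hV hW hΨ hg hqc fun σ hσ => ?_
    rw [hgz σ hσ]
    nlinarith [hxq σ hσ]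
  obtain ⟨r, hr0, hr1, hr⟩ := hpext (fun ρ => g ρ + ρ (-x))
    (hg.add_eval (-x) fun ρ hρ => by simpa using hxg ρ hρ)
    (fun ρ hρ => by simpa [add_comm] using hgq ρ hρ)
  have hgr : ∀ ρ ∈ stateSpace P v, g ρ = ρ x + r * p ρ := fun ρ hρ => by
    rw [← hr ρ hρ, map_neg]
    ring
  have hscale : ∀ l : ℝ, 0 ≤ l → ∀ σ ∈ stateSpace Q w,
      cuscExt P v Ψ (fun ρ => (1 + l) * ρ x) σ = (1 + l) * σ (Ψ x) := fun l hl σ hσ => by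
    rw [cuscExt_smul hV hW hΨ hxc (by linarith) σ hσ, hFx σ hσ]
  have hlc : ∀ l : ℝ, 0 ≤ l → memCusc (stateSpace P v) fun ρ => (1 + l) * ρ x :=
    fun l hl => hxc.const_mul (by linarith)
  have hgauge : ∀ l : ℝ, 0 ≤ l → ((∀ ρ ∈ stateSpace P v, r * p ρ ≤ l * ρ x) ↔
      ∀ ρ ∈ stateSpace P v, s * p ρ ≤ l * ρ x) := by
    intro l hl
    have hls : 0 ≤ l / s := by positivity
    have e : l / s * s = l := div_mul_cancel₀ l hs0.ne'
    constructor
    · intro h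
      have h1 := cuscExt_mono hV hW hΨ hg (hlc l hl) fun ρ hρ => by
        linarith [h ρ hρ, hgr ρ hρ]
      have h2 := le_of_cuscExt_le hV hW hΨ hqc (hlc _ hls) fun σ hσ => by
        have h3 := h1 σ hσ
        rw [hgz σ hσ, hscale l hl σ hσ] at h3
        rw [hscale _ hls σ hσ]
        refine le_of_mul_le_mul_left ?_ hs0
        linear_combination h3 - σ (Ψ x) * e
      intro ρ hρ
      have h3 := mul_le_mul_of_nonneg_left (h2 ρ hρ) hs0.le
      linear_combination h3 + ρ x * e
    · intro h
      have h1 := cuscExt_mono hV hW hΨ hqc (hlc _ hls) fun ρ hρ => by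
        refine le_of_mul_le_mul_left ?_ hs0
        linear_combination h ρ hρ - ρ x * e
      have h2 := le_of_cuscExt_le hV hW hΨ hg (hlc l hl) fun σ hσ => by
        have h3 := mul_le_mul_of_nonneg_left (h1 σ hσ) hs0.le
        rw [hscale _ hls σ hσ] at h3
        rw [hgz σ hσ, hscale l hl σ hσ]
        linear_combination h3 + σ (Ψ x) * e
      intro ρ hρ
      linarith [h2 ρ hρ, hgr ρ hρ]
  have hbdd := exists_le_mul_eval hV hpc hx
  have hrs : r = s := le_antisymm
    (le_of_gauge_le hxpos hpc.1 hp0 hbdd hs0.le fun l hl => (hgauge l hl).2)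
    (le_of_gauge_le hxpos hpc.1 hp0 hbdd hr0 fun l hl => (hgauge l hl).1)
  intro σ hσ
  rw [← hgz σ hσ]
  exact cuscExt_congr hV hW hΨ (hxc.add (hpc.const_mul hs0.le)) hg
    (fun ρ hρ => by rw [hgr ρ hρ, hrs]) σ hσ

theorem cuscExt_eval_add_extremal (hV : IsOrderUnitSpace V P v)
    (hW : IsOrderUnitSpace W Q w) (hΨ : GaugePreserving P v Q w Ψ) {x : V}
    (hx : x ∈ openCone P v) {p : WeakDual ℝ V → ℝ} (hp : IsExtremalCusc (stateSpace P v) p) :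
    ∀ σ ∈ stateSpace Q w, cuscExt P v Ψ (fun ρ => ρ x + p ρ) σ =
      σ (Ψ x) + cuscExt P v Ψ p σ := by
  have hpc := hp.1
  have hxc := memCusc_of_mem_openCone hV hx
  have hxpos := hV.mem_openCone_iff.1 hx
  have hqc := hxc.add hpc
  have hFq := memCusc_cuscExt hV hW hΨ hqc
  have hFx := cuscExt_eval hV hW hΨ hx
  have hΨpos := hW.mem_openCone_iff.1 (hΨ.1.mapsTo hx)
  have hscaled : ∀ s : ℝ, 0 < s → s ≤ 1 → ∀ σ ∈ stateSpace Q w,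
      cuscExt P v Ψ (fun ρ => s * ρ x + p ρ) σ =
        cuscExt P v Ψ (fun ρ => ρ x + p ρ) σ - (1 - s) * σ (Ψ x) := by
    intro s hs0 hs1 σ hσ
    have h1 := cuscExt_eval_add_mul_extremal hV hW hΨ (smul_mem_openCone hV hx hs0) hp hs0 hs1 σ hσ
    have h2 := cuscExt_smul hV hW hΨ hqc hs0 σ hσ
    simp only [hΨ.2.1 x hx s hs0, map_smul, smul_eq_mul] at h1
    simp only [mul_add] at h2
    rw [h2] at h1
    refine mul_left_cancel₀ hs0.ne' ?_
    linear_combination -h1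
  have hsc : ∀ s : ℝ, 0 < s → memCusc (stateSpace P v) fun ρ => s * ρ x + p ρ :=
    fun s hs => (hxc.const_mul hs.le).add hpc
  have hyc : memCusc (stateSpace Q w)
      fun σ => cuscExt P v Ψ (fun ρ => ρ x + p ρ) σ + σ (-Ψ x) := by
    refine hFq.add_eval _ fun σ hσ => ?_
    have := cuscExt_mono hV hW hΨ hxc hqc (fun ρ hρ => by simpa using hpc.1 ρ hρ) σ hσ
    rw [hFx σ hσ] at this
    simpa using this
  obtain ⟨g, hg, hgy⟩ := exists_cuscExt_eq hV hW hΨ hyc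
  have hgp : ∀ ρ ∈ stateSpace P v, g ρ ≤ p ρ := by
    intro ρ hρ
    refine le_of_forall_pos_le_add fun ε hε => ?_
    have hpos := hxpos ρ hρ
    set s := min 1 (ε / ρ x)
    have hs0 : 0 < s := by positivity
    have h := le_of_cuscExt_le hV hW hΨ hg (hsc s hs0) (fun σ hσ => by
      rw [hgy σ hσ, hscaled s hs0 (min_le_left _ _) σ hσ, map_neg]
      nlinarith [hΨpos σ hσ]) ρ hρ
    have h2 : s * ρ x ≤ ε := (le_div_iff₀ hpos).1 (min_le_right _ _)
    linarith
  intro σ hσ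
  apply le_antisymm
  · have h1 := cuscExt_mono hV hW hΨ hg hpc hgp σ hσ
    rw [hgy σ hσ, map_neg] at h1
    linarith
  · refine le_of_forall_pos_le_add fun ε hε => ?_
    have hpos := hΨpos σ hσ
    set s := min 1 (ε / σ (Ψ x))
    have hs0 : 0 < s := by positivity
    have h1 := cuscExt_mono hV hW hΨ hpc (hsc s hs0)
      (fun ρ hρ => by have := mul_pos hs0 (hxpos ρ hρ); linarith) σ hσ
    rw [hscaled s hs0 (min_le_left _ _) σ hσ] at h1
    have h2 : s * σ (Ψ x) ≤ ε := (le_div_iff₀ hpos).1 (min_le_right _ _)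
    linarith

/-- A gauge-preserving bijection is additive when the extended cone is strongly atomic. -/
theorem GaugePreserving.map_add (hV : IsOrderUnitSpace V P v) (hW : IsOrderUnitSpace W Q w)
    (hatomic : StronglyAtomicCusc (stateSpace P v)) (hΨ : GaugePreserving P v Q w Ψ) {x y : V}
    (hx : x ∈ openCone P v) (hy : y ∈ openCone P v) : Ψ (x + y) = Ψ x + Ψ y := by
  have hxy := add_mem_openCone hV hx hy
  have hxc := memCusc_of_mem_openCone hV hx
  have hyc := memCusc_of_mem_openCone hV hy
  have hxyc := memCusc_of_mem_openCone hV hxy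
  refine hW.eq_of_states fun σ hσ => le_antisymm ?_ ?_
  · have hb := add_mem_openCone hW (hΨ.1.mapsTo hx) (hΨ.1.mapsTo hy)
    obtain ⟨c, hc, hcb⟩ := hΨ.1.surjOn hb
    have hcc := memCusc_of_mem_openCone hV hc
    have hFc := cuscExt_eval hV hW hΨ hc
    have hxc' : ∀ ρ ∈ stateSpace P v, ρ x ≤ ρ c := by
      refine hV.sub_mem_iff.1 ((hΨ.2.2 x hx c hc).2 (hW.sub_mem_iff.2 fun τ hτ => ?_))
      simpa [hcb] using (hW.mem_openCone_iff.1 (hΨ.1.mapsTo hy) τ hτ).le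
    have hle : ∀ ρ ∈ stateSpace P v, ρ y ≤ ρ (c - x) := by
      refine (hatomic _ hyc).2 (fun ρ => ρ (c - x))
        (memCusc_eval _ fun ρ hρ => by simpa using hxc' ρ hρ) fun p hp hpy => ?_
      have h := le_of_cuscExt_le hV hW hΨ (hxc.add hp.1) hcc fun τ hτ => by
        rw [cuscExt_eval_add_extremal hV hW hΨ hx hp τ hτ, hFc τ hτ, hcb, _root_.map_add]
        have := cuscExt_mono hV hW hΨ hp.1 hyc hpy τ hτ
        rw [cuscExt_eval hV hW hΨ hy τ hτ] at this
        linarith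
      intro ρ hρ
      have := h ρ hρ
      rw [map_sub]
      linarith
    rw [← hcb]
    refine hW.sub_mem_iff.1 ((hΨ.2.2 _ hxy c hc).1 (hV.sub_mem_iff.2 fun ρ hρ => ?_)) σ hσ
    have := hle ρ hρ
    rw [map_sub] at this
    rw [_root_.map_add]
    linarith
  · have hz : memCusc (stateSpace Q w) fun τ => τ (Ψ (x + y) - Ψ x) := by
      refine memCusc_eval _ fun τ hτ => ?_
      have := hW.sub_mem_iff.1 ((hΨ.2.2 x hx _ hxy).1 (hV.sub_mem_iff.2 fun ρ hρ => by
        simpa using (hV.mem_openCone_iff.1 hy ρ hρ).le)) τ hτ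
      simpa using this
    obtain ⟨g, hg, hgz⟩ := exists_cuscExt_eq hV hW hΨ hz
    have hyg : ∀ ρ ∈ stateSpace P v, ρ y ≤ g ρ := by
      refine (hatomic _ hyc).2 g hg fun p hp hpy => ?_
      refine le_of_cuscExt_le hV hW hΨ hp.1 hg fun τ hτ => ?_
      have h := cuscExt_mono hV hW hΨ (hxc.add hp.1) hxyc (fun ρ hρ => by
        simpa using hpy ρ hρ) τ hτ
      rw [cuscExt_eval_add_extremal hV hW hΨ hx hp τ hτ, cuscExt_eval hV hW hΨ hxy τ hτ] at h
      rw [hgz τ hτ, map_sub]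
      linarith
    have h := cuscExt_mono hV hW hΨ hyc hg hyg σ hσ
    rw [cuscExt_eval hV hW hΨ hy σ hσ, hgz σ hσ, map_sub] at h
    rw [_root_.map_add]
    linarith

theorem add_smul_mem_openCone (hV : IsOrderUnitSpace V P v) (x : V) :
    x + (‖x‖ + 1) • v ∈ openCone P v := by
  refine ⟨1, one_pos, ?_⟩
  convert hV.norm_smul_sub_mem (-x) using 1
  rw [norm_neg]
  module

/-- An additive, positively homogeneous map on the open cone extends linearly. -/
theorem exists_linear_extension (hV : IsOrderUnitSpace V P v)
    (hadd : ∀ x ∈ openCone P v, ∀ y ∈ openCone P v, Ψ (x + y) = Ψ x + Ψ y)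
    (hsmul : ∀ x ∈ openCone P v, ∀ r : ℝ, 0 < r → Ψ (r • x) = r • Ψ x) :
    ∃ T : V →ₗ[ℝ] W, ∀ x ∈ openCone P v, T x = Ψ x := by
  have hC := fun x => add_smul_mem_openCone hV x
  have hU : ∀ x : V, (‖x‖ + 1) • v ∈ openCone P v := fun x =>
    smul_mem_openCone hV hV.unit_mem_openCone (by positivity)
  let T : V → W := fun x => Ψ (x + (‖x‖ + 1) • v) - Ψ ((‖x‖ + 1) • v)
  have hT : ∀ x, ∀ a ∈ openCone P v, ∀ b ∈ openCone P v, x = a - b → T x = Ψ a - Ψ b := by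
    intro x a ha b hb hx
    have h1 := hadd _ (hC x) _ hb
    have h2 := hadd _ ha _ (hU x)
    have h3 : x + (‖x‖ + 1) • v + b = a + (‖x‖ + 1) • v := by
      nth_rw 1 [hx]
      abel
    rw [h3, h2] at h1
    simp only [T]
    rw [sub_eq_sub_iff_add_eq_add, ← h1]
  have hdecomp : ∀ x, ∃ a ∈ openCone P v, ∃ b ∈ openCone P v, x = a - b := fun x =>
    ⟨_, hC x, _, hU x, by abel⟩
  refine ⟨{ toFun := T, map_add' := fun x y => ?_, map_smul' := fun r x => ?_ }, fun x hx => ?_⟩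
  · obtain ⟨a, ha, b, hb, hx⟩ := hdecomp x
    obtain ⟨c, hc, d, hd, hy⟩ := hdecomp y
    rw [hT _ _ ha _ hb hx, hT _ _ hc _ hd hy, hT _ _ (add_mem_openCone hV ha hc) _
      (add_mem_openCone hV hb hd) (by rw [hx, hy]; abel), hadd a ha c hc, hadd b hb d hd]
    abel
  · obtain ⟨a, ha, b, hb, hx⟩ := hdecomp x
    rw [hT _ _ ha _ hb hx, RingHom.id_apply]
    rcases lt_trichotomy r 0 with hr | rfl | hr
    · have hr' : 0 < -r := neg_pos.2 hr
      rw [hT _ _ (smul_mem_openCone hV hb hr') _ (smul_mem_openCone hV ha hr')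
        (by rw [hx]; module), hsmul b hb _ hr', hsmul a ha _ hr']
      module
    · rw [hT _ _ ha _ ha (by simp)]
      simp
    · rw [hT _ _ (smul_mem_openCone hV ha hr) _ (smul_mem_openCone hV hb hr)
        (by rw [hx, smul_sub]), hsmul b hb _ hr, hsmul a ha _ hr, smul_sub]
  · change T x = Ψ x
    rw [hT x _ (add_mem_openCone hV hx hx) x hx (by abel), hadd x hx x hx]
    abel

end Additivity

/-- (Noll–Schäfer for strongly atomic cones.) Let `(V, P, v)` and
`(W, Q, w)` be complete order unit spaces such that the cone `C_usc` over the state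
space of `(V, P, v)` is strongly atomic, and let `Ψ` be a gauge-preserving bijection
between the open cones with `Ψ v = w`. Then `Ψ` extends to an isomorphism of order
unit spaces. -/
theorem gaugePreserving_extends_of_stronglyAtomic
    {V : Type*} [NormedAddCommGroup V] [NormedSpace ℝ V] [CompleteSpace V]
    {W : Type*} [NormedAddCommGroup W] [NormedSpace ℝ W] [CompleteSpace W]
    (P : Set V) (v : V) (Q : Set W) (w : W)
    (hV : IsOrderUnitSpace V P v) (hW : IsOrderUnitSpace W Q w)
    (hatomic : StronglyAtomicCusc (stateSpace P v))
    (Ψ : V → W) (hΨ : GaugePreserving P v Q w Ψ) (hΨv : Ψ v = w) :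
    ∃ T : V →ₗ[ℝ] W, Function.Bijective T ∧ (⇑T) '' P = Q ∧ T v = w ∧
      ∀ x ∈ openCone P v, T x = Ψ x := by
  obtain ⟨T, hT⟩ := exists_linear_extension hV
    (fun x hx y hy => hΨ.map_add hV hW hatomic hx hy) hΨ.2.1
  have hTv : T v = w := by rw [hT v hV.unit_mem_openCone, hΨv]
  have hpos : ∀ x, x ∈ P ↔ T x ∈ Q := by
    intro x
    have hN : (‖x‖ + 1) • v ∈ openCone P v :=
      smul_mem_openCone hV hV.unit_mem_openCone (by positivity)
    have h := hΨ.2.2 _ hN _ (add_smul_mem_openCone hV x)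
    rwa [← hT _ hN, ← hT _ (add_smul_mem_openCone hV x), ← map_sub, add_sub_cancel_right] at h
  have hsurj : Function.Surjective T := by
    intro y
    obtain ⟨a, ha, hay⟩ := hΨ.1.surjOn (add_smul_mem_openCone hW y)
    refine ⟨a - (‖y‖ + 1) • v, ?_⟩
    rw [map_sub, map_smul, hT a ha, hay, hTv, add_sub_cancel_right]
  refine ⟨T, ⟨(injective_iff_map_eq_zero T).2 fun x hx => hV.proper x ?_ ?_, hsurj⟩, ?_, hTv, hT⟩
  · exact (hpos x).2 (hx ▸ hW.zero_mem)
  · exact (hpos (-x)).2 (by simpa [hx] using hW.zero_mem)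
  · ext y
    constructor
    · rintro ⟨x, hx, rfl⟩
      exact (hpos x).1 hx
    · intro hy
      obtain ⟨x, rfl⟩ := hsurj y
      exact ⟨x, (hpos x).2 hy, rfl⟩
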